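/- Let Ω ⊂ ℂ be a domain, n ≥ 0, and let f⁽⁰⁾, …, f⁽ⁿ⁾ : Ω → ℝ be C² functions such that f⁽⁰⁾_ww·f⁽⁰⁾_w̄w̄ > 0 on Ω. Set f(w, t) = Σ_{m=0}^{n} f⁽ᵐ⁾(w)·tᵐ/m!. Then, for each fixed w ∈ Ω, f_{ww̄}(w, t) = t·√( f_{ww}(w, t)·f_{w̄w̄}(w, t) ) + o(tⁿ) as t → 0 if and only if for every m = 0, 1, …, n: f⁽ᵐ⁾_{ww̄} = [ m·Σ_{r=0}^{m−1} C(m−1, r)·f⁽ʳ⁾_{ww}·f⁽ᵐ⁻ʳ⁻¹⁾_{w̄w̄} − (1/(m+1))·Σ_{r=2}^{m−1} C(m+1, r)·f⁽ʳ⁾_{ww̄}·f⁽ᵐ⁻ʳ⁺¹⁾_{ww̄} ] / ( 2^{1−δ_{m1}}·√( f⁽⁰⁾_{ww}·f⁽⁰⁾_{w̄w̄} ) ). -/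

import Mathlib

open Set Filter Asymptotics
open scoped BigOperators Topology

noncomputable section

/-- Partial derivative in `x = Re w` of a complex-valued function of `w`. -/
def cpdx (g : ℂ → ℂ) (w : ℂ) : ℂ :=
  deriv (fun x : ℝ => g ((x : ℂ) + (w.im : ℂ) * Complex.I)) w.re

/-- Partial derivative in `y = Im w` of a complex-valued function of `w`. -/
def cpdy (g : ℂ → ℂ) (w : ℂ) : ℂ :=
  deriv (fun y : ℝ => g ((w.re : ℂ) + (y : ℂ) * Complex.I)) w.im

/-- The Wirtinger derivative `∂/∂w = (∂/∂x - i ∂/∂y)/2`. -/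
def wD (g : ℂ → ℂ) : ℂ → ℂ := fun w => (cpdx g w - Complex.I * cpdy g w) / 2

/-- The conjugate Wirtinger derivative `∂/∂w̄ = (∂/∂x + i ∂/∂y)/2`. -/
def wDbar (g : ℂ → ℂ) : ℂ → ℂ := fun w => (cpdx g w + Complex.I * cpdy g w) / 2

/-- A real-valued function viewed as a complex-valued one. -/
def cplx (f : ℂ → ℝ) : ℂ → ℂ := fun w => (f w : ℂ)

/-- `f_ww` for a real-valued function `f`. -/
def fww (f : ℂ → ℝ) : ℂ → ℂ := wD (wD (cplx f))

/-- `f_ww̄` for a real-valued function `f`. -/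
def fwwbar (f : ℂ → ℝ) : ℂ → ℂ := wDbar (wD (cplx f))

/-- `f_w̄w̄` for a real-valued function `f`. -/
def fwbarwbar (f : ℂ → ℝ) : ℂ → ℂ := wDbar (wDbar (cplx f))

/-- Partial derivative in `x = Re w` of a real-valued function of `w`. -/
def rpdx (f : ℂ → ℝ) (w : ℂ) : ℝ :=
  deriv (fun x : ℝ => f ((x : ℂ) + (w.im : ℂ) * Complex.I)) w.re

/-- Partial derivative in `y = Im w` of a real-valued function of `w`. -/
def rpdy (f : ℂ → ℝ) (w : ℂ) : ℝ :=
  deriv (fun y : ℝ => f ((w.re : ℂ) + (y : ℂ) * Complex.I)) w.im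

/-- generic first-order operator -/
def genL (c : ℂ) (g : ℂ → ℂ) : ℂ → ℂ := fun w => (cpdx g w + c * cpdy g w) / 2

lemma wD_eq_genL : wD = genL (-Complex.I) := by
  funext g w; simp only [wD, genL]; ring

lemma wDbar_eq_genL : wDbar = genL Complex.I := by
  funext g w; simp only [wDbar, genL]

lemma cpdx_eq {g : ℂ → ℂ} {w : ℂ} (hg : DifferentiableAt ℝ g w) :
    cpdx g w = fderiv ℝ g w 1 := by
  have h1 : HasDerivAt (fun x : ℝ => (x : ℂ) + (w.im : ℂ) * Complex.I) 1 w.re :=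
    (Complex.ofRealCLM.hasDerivAt (x := w.re)).add_const _
  have hw : (w.re : ℂ) + (w.im : ℂ) * Complex.I = w := Complex.re_add_im w
  have h2 : HasFDerivAt g (fderiv ℝ g w) ((w.re : ℂ) + (w.im : ℂ) * Complex.I) := by
    rw [hw]; exact hg.hasFDerivAt
  exact (h2.comp_hasDerivAt w.re h1).deriv

lemma cpdy_eq {g : ℂ → ℂ} {w : ℂ} (hg : DifferentiableAt ℝ g w) :
    cpdy g w = fderiv ℝ g w Complex.I := by
  have h1 : HasDerivAt (fun y : ℝ => (w.re : ℂ) + (y : ℂ) * Complex.I) Complex.I w.im := by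
    have := ((Complex.ofRealCLM.hasDerivAt (x := w.im)).mul_const Complex.I).const_add (w.re : ℂ)
    simpa using this
  have hw : (w.re : ℂ) + (w.im : ℂ) * Complex.I = w := Complex.re_add_im w
  have h2 : HasFDerivAt g (fderiv ℝ g w) ((w.re : ℂ) + (w.im : ℂ) * Complex.I) := by
    rw [hw]; exact hg.hasFDerivAt
  exact (h2.comp_hasDerivAt w.im h1).deriv

lemma genL_eq {g : ℂ → ℂ} {w : ℂ} (c : ℂ) (hg : DifferentiableAt ℝ g w) :
    genL c g w = (fderiv ℝ g w 1 + c * fderiv ℝ g w Complex.I) / 2 := by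
  rw [genL, cpdx_eq hg, cpdy_eq hg]

lemma genL_sum {ι : Type} (s : Finset ι) (c : ℂ) (g : ι → ℂ → ℂ) (b : ι → ℂ) (w : ℂ)
    (hg : ∀ i ∈ s, DifferentiableAt ℝ (g i) w) :
    genL c (fun z => ∑ i ∈ s, b i * g i z) w = ∑ i ∈ s, b i * genL c (g i) w := by
  have hd : ∀ i ∈ s, DifferentiableAt ℝ (fun z => b i * g i z) w :=
    fun i hi => (hg i hi).const_mul (b i)
  rw [genL_eq c (DifferentiableAt.fun_sum hd), fderiv_fun_sum hd]
  simp only [_root_.sum_apply]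
  rw [Finset.mul_sum, ← Finset.sum_add_distrib, Finset.sum_div]
  refine Finset.sum_congr rfl fun i hi => ?_
  rw [genL_eq c (hg i hi), fderiv_const_mul (hg i hi)]
  simp only [_root_.smul_apply, smul_eq_mul]
  ring

lemma genL_congr {g h : ℂ → ℂ} {w : ℂ} (c : ℂ) (hg : DifferentiableAt ℝ g w) (e : g =ᶠ[𝓝 w] h) :
    genL c g w = genL c h w := by
  rw [genL_eq c hg, genL_eq c (hg.congr_of_eventuallyEq e.symm), e.fderiv_eq]

lemma genL_contDiffOn {Ω : Set ℂ} (hΩ : IsOpen Ω) {g : ℂ → ℂ} (c : ℂ)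
    (hg : ContDiffOn ℝ 2 g Ω) : ContDiffOn ℝ 1 (genL c g) Ω := by
  have h1 : ContDiffOn ℝ 1 (fderiv ℝ g) Ω := hg.fderiv_of_isOpen hΩ (by norm_num)
  have h2 : ContDiffOn ℝ 1 (fun w => (fderiv ℝ g w 1 + c * fderiv ℝ g w Complex.I) / 2) Ω := by
    have ha : ContDiffOn ℝ 1 (fun w => fderiv ℝ g w 1) Ω := h1.clm_apply contDiffOn_const
    have hb : ContDiffOn ℝ 1 (fun w => fderiv ℝ g w Complex.I) Ω := h1.clm_apply contDiffOn_const
    exact (ha.add (contDiffOn_const.mul hb)).div_const 2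
  refine h2.congr fun w hw => genL_eq c ?_
  exact (hg.contDiffAt (hΩ.mem_nhds hw)).differentiableAt (by norm_num)

lemma genL_genL_sum {Ω : Set ℂ} (hΩ : IsOpen Ω) {ι : Type} (s : Finset ι) (c d : ℂ)
    (g : ι → ℂ → ℂ) (b : ι → ℂ) (hg : ∀ i ∈ s, ContDiffOn ℝ 2 (g i) Ω) {w : ℂ} (hw : w ∈ Ω) :
    genL d (genL c (fun z => ∑ i ∈ s, b i * g i z)) w
      = ∑ i ∈ s, b i * genL d (genL c (g i)) w := by
  have hd : ∀ i ∈ s, ∀ z ∈ Ω, DifferentiableAt ℝ (g i) z := fun i hi z hz =>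
    ((hg i hi).contDiffAt (hΩ.mem_nhds hz)).differentiableAt (by norm_num)
  have hd2 : ∀ i ∈ s, DifferentiableAt ℝ (genL c (g i)) w := fun i hi =>
    ((genL_contDiffOn hΩ c (hg i hi)).contDiffAt (hΩ.mem_nhds hw)).differentiableAt (by norm_num)
  rw [← genL_sum s d _ b w hd2]
  symm
  refine genL_congr d (DifferentiableAt.fun_sum fun i hi => (hd2 i hi).const_mul _) ?_
  filter_upwards [hΩ.mem_nhds hw] with z hz
  exact (genL_sum s c g b z fun i hi => hd i hi z hz).symm

lemma cpdx_conj (g : ℂ → ℂ) (w : ℂ) :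
    cpdx (fun z => (starRingEnd ℂ) (g z)) w = (starRingEnd ℂ) (cpdx g w) := by
  unfold cpdx; exact deriv.star (f := fun x : ℝ => g ((x : ℂ) + (w.im : ℂ) * Complex.I))

lemma cpdy_conj (g : ℂ → ℂ) (w : ℂ) :
    cpdy (fun z => (starRingEnd ℂ) (g z)) w = (starRingEnd ℂ) (cpdy g w) := by
  unfold cpdy; exact deriv.star (f := fun y : ℝ => g ((w.re : ℂ) + (y : ℂ) * Complex.I))

lemma wDbar_conj (g : ℂ → ℂ) :
    wDbar (fun z => (starRingEnd ℂ) (g z)) = fun w => (starRingEnd ℂ) (wD g w) := by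
  funext w
  simp only [wDbar, wD, cpdx_conj, cpdy_conj, map_div₀, map_sub, map_mul, Complex.conj_I, map_ofNat]
  ring

lemma fwbarwbar_eq (f : ℂ → ℝ) (w : ℂ) : fwbarwbar f w = (starRingEnd ℂ) (fww f w) := by
  have h : cplx f = fun z => (starRingEnd ℂ) (cplx f z) := by
    funext z; simp [cplx]
  rw [fwbarwbar, fww, h, wDbar_conj, wDbar_conj, ← h]

lemma gen_expand {Ω : Set ℂ} (hΩ : IsOpen Ω) {n : ℕ} {f : ℕ → ℂ → ℝ}
    (hC2 : ∀ m ≤ n, ContDiffOn ℝ 2 (f m) Ω) {F : ℝ → ℂ → ℝ}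
    (hF : ∀ t w, F t w = ∑ m ∈ Finset.range (n + 1), f m w * t ^ m / (m.factorial : ℝ))
    (c d : ℂ) {w : ℂ} (hw : w ∈ Ω) (t : ℝ) :
    genL d (genL c (cplx (F t))) w
      = ∑ m ∈ Finset.range (n + 1), ((t : ℂ) ^ m / (m.factorial : ℂ)) *
          genL d (genL c (cplx (f m))) w := by
  have h : cplx (F t) = fun z => ∑ m ∈ Finset.range (n + 1),
      ((t : ℂ) ^ m / (m.factorial : ℂ)) * cplx (f m) z := by
    funext z
    simp only [cplx, hF]
    push_cast
    exact Finset.sum_congr rfl fun i _ => by ring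
  rw [h]
  refine genL_genL_sum hΩ _ c d _ _ (fun i hi => ?_) hw
  exact Complex.ofRealCLM.contDiff.comp_contDiffOn (hC2 i (Nat.lt_succ_iff.1 (Finset.mem_range.1 hi)))

open Polynomial in
lemma poly_isLittleO (p : ℂ[X]) (N : ℕ) :
    ((fun t : ℝ => p.eval (t : ℂ)) =o[𝓝 (0 : ℝ)] (fun t : ℝ => t ^ N)) ↔
      ∀ k ≤ N, p.coeff k = 0 := by
  have hcont : ∀ q : ℂ[X], Continuous fun t : ℝ => q.eval (t : ℂ) := fun q =>
    q.continuous.comp Complex.continuous_ofReal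
  constructor
  · intro h k
    induction k using Nat.strong_induction_on with
    | _ k ih =>
      intro hk
      have hdvd : X ^ k ∣ p := Polynomial.X_pow_dvd_iff.2 fun d hd => ih d hd (by omega)
      obtain ⟨q, rfl⟩ := hdvd
      have h1 : (fun t : ℝ => ((X ^ k * q).eval (t : ℂ))) =o[𝓝 (0 : ℝ)] (fun t : ℝ => t ^ k) := by
        refine h.trans_isBigO ?_
        obtain ⟨j, rfl⟩ := Nat.exists_eq_add_of_le hk
        have : (fun t : ℝ => t ^ j) =O[𝓝 (0:ℝ)] (fun _ => (1:ℝ)) :=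
          ((continuous_pow j).tendsto 0).isBigO_one ℝ
        have h3 := (isBigO_refl (fun t : ℝ => t ^ k) (𝓝 0)).mul this
        simpa [pow_add] using h3
      have h2 : Tendsto (fun t : ℝ => q.eval (t : ℂ)) (𝓝[≠] 0) (𝓝 0) := by
        rw [Metric.tendsto_nhds]
        intro ε hε
        have h5 := h1.def (half_pos hε)
        filter_upwards [h5.filter_mono nhdsWithin_le_nhds, self_mem_nhdsWithin] with t ht ht0
        have ht1 : 0 < ‖t‖ ^ k := pow_pos (norm_pos_iff.2 ht0) k
        simp only [Polynomial.eval_mul, Polynomial.eval_pow, Polynomial.eval_X, norm_mul, norm_pow,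
          Complex.norm_real] at ht
        rw [dist_zero_right]
        have : ‖q.eval (t : ℂ)‖ ≤ ε / 2 := by
          by_contra hc
          push Not at hc
          nlinarith
        linarith
      have h3 : Tendsto (fun t : ℝ => q.eval (t : ℂ)) (𝓝[≠] 0) (𝓝 (q.eval ((0:ℝ) : ℂ))) :=
        ((hcont q).tendsto 0).mono_left nhdsWithin_le_nhds
      have h4 := tendsto_nhds_unique h2 h3
      rw [Polynomial.coeff_X_pow_mul', if_pos le_rfl, Nat.sub_self, Polynomial.coeff_zero_eq_eval_zero]
      simpa using h4.symm
  · intro h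
    have hdvd : X ^ (N + 1) ∣ p := Polynomial.X_pow_dvd_iff.2 fun d hd => h d (by omega)
    obtain ⟨q, rfl⟩ := hdvd
    have h1 : (fun t : ℝ => (t : ℂ) * q.eval (t : ℂ)) =o[𝓝 (0 : ℝ)] (fun _ => (1 : ℝ)) := by
      rw [isLittleO_one_iff]
      have := (Complex.continuous_ofReal.fun_mul (hcont q)).tendsto 0
      simpa using this
    have h2 : (fun t : ℝ => (t : ℂ) ^ N) =O[𝓝 (0 : ℝ)] (fun t : ℝ => t ^ N) :=
      IsBigO.of_bound 1 (by simp)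
    have := h2.mul_isLittleO h1
    refine (this.congr_left fun t => ?_).congr_right fun t => by ring
    simp; ring

open Polynomial in
/-- truncated exponential generating polynomial -/
def egf (n : ℕ) (a : ℕ → ℂ) : ℂ[X] := ∑ m ∈ Finset.range (n + 1), C (a m / (m.factorial : ℂ)) * X ^ m

lemma egf_coeff (n : ℕ) (a : ℕ → ℂ) (k : ℕ) (hk : k ≤ n) :
    (egf n a).coeff k = a k / (k.factorial : ℂ) := by
  simp [egf, Polynomial.coeff_C_mul, Polynomial.coeff_X_pow]
  omega

lemma egf_eval (n : ℕ) (a : ℕ → ℂ) (t : ℂ) :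
    (egf n a).eval t = ∑ m ∈ Finset.range (n + 1), (t ^ m / (m.factorial : ℂ)) * a m := by
  simp only [egf, Polynomial.eval_finsetSum, Polynomial.eval_mul, Polynomial.eval_C,
    Polynomial.eval_pow, Polynomial.eval_X]
  exact Finset.sum_congr rfl fun i _ => by ring

/-- right-hand side of the recursion -/
def recRHS (a u v : ℕ → ℂ) (s : ℂ) (m : ℕ) : ℂ :=
  ((m : ℂ) * ∑ r ∈ Finset.range m, (((m - 1).choose r : ℕ) : ℂ) * (u r * v (m - r - 1))
          - (1 / ((m : ℂ) + 1)) * ∑ r ∈ Finset.Icc 2 (m - 1), (((m + 1).choose r : ℕ) : ℂ) *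
            (a r * a (m - r + 1)))
        / ((2 : ℂ) ^ (1 - (if m = 1 then 1 else 0) : ℕ) * s)

open Polynomial in
/-- the discriminating polynomial -/
def dPoly (n : ℕ) (a u v : ℕ → ℂ) : ℂ[X] :=
  egf n a * egf n a - X ^ 2 * (egf n u * egf n v)

lemma recRHS_zero (a u v : ℕ → ℂ) (s : ℂ) : recRHS a u v s 0 = 0 := by
  simp [recRHS]

lemma recRHS_one (a u v : ℕ → ℂ) (s : ℂ) (hs : s ≠ 0) (h : s * s = u 0 * v 0) :
    recRHS a u v s 1 = s := by
  simp [recRHS, ← h, hs]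

lemma uv_sum (n : ℕ) (u v : ℕ → ℂ) (k : ℕ) (hk : k ≤ n) :
    ∑ r ∈ Finset.range (k + 1), ((k.choose r : ℕ) : ℂ) * (u r * v (k - r))
      = (k.factorial : ℂ) * (egf n u * egf n v).coeff k := by
  rw [Polynomial.coeff_mul, Finset.Nat.sum_antidiagonal_eq_sum_range_succ_mk, Finset.mul_sum]
  refine Finset.sum_congr rfl fun r hr => ?_
  have hr' : r ≤ k := Nat.lt_succ_iff.1 (Finset.mem_range.1 hr)
  rw [egf_coeff n u r (by omega), egf_coeff n v (k - r) (by omega), Nat.cast_choose ℂ hr']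
  have := Nat.factorial_ne_zero r
  have := Nat.factorial_ne_zero (k - r)
  field_simp

lemma aa_coeff (n : ℕ) (a : ℕ → ℂ) (h0 : a 0 = 0) (k : ℕ) (hk : k + 2 ≤ n) :
    ((k + 3).factorial : ℂ) * (egf n a * egf n a).coeff (k + 3)
      = 2 * (k + 3) * a 1 * a (k + 2) + 
        ∑ r ∈ Finset.Icc 2 (k + 1), (((k + 3).choose r : ℕ) : ℂ) * (a r * a (k + 2 - r + 1)) := by
  have hz : (egf n a).coeff 0 = 0 := by rw [egf_coeff n a 0 (by omega), h0]; simp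
  have e1 : Finset.Icc 2 (k + 1) = Finset.Ico 2 (k + 2) := by ext; simp; omega
  rw [Polynomial.coeff_mul, Finset.Nat.sum_antidiagonal_eq_sum_range_succ_mk, e1,
    Finset.sum_Ico_eq_sum_range, Finset.sum_range_succ, Finset.sum_range_succ,
    Finset.sum_range_succ', Finset.sum_range_succ']
  simp only [Nat.sub_self, hz, mul_zero, zero_mul, add_zero, Nat.add_sub_cancel]
  rw [mul_add, mul_add, Finset.mul_sum]
  have e2 : k + 3 - (k + 2) = 1 := by omega
  have e3 : k + 3 - (0 + 1) = k + 2 := by omega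
  rw [e2, e3, egf_coeff n a (0+1) (by omega), egf_coeff n a (k+2) hk]
  have e4 : ((k + 3).factorial : ℂ) = (k + 3) * ((k + 2).factorial : ℂ) := by
    rw [Nat.factorial_succ]; push_cast; ring
  have hf := Nat.factorial_ne_zero (k + 2)
  have e5 : ∑ i ∈ Finset.range k, ((k + 3).factorial : ℂ) *
      ((egf n a).coeff (i + 1 + 1) * (egf n a).coeff (k + 3 - (i + 1 + 1)))
      = ∑ i ∈ Finset.range k, (((k + 3).choose (2 + i) : ℕ) : ℂ) *
        (a (2 + i) * a (k + 2 - (2 + i) + 1)) := by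
    refine Finset.sum_congr rfl fun i hi => ?_
    have hi' := Finset.mem_range.1 hi
    have e6 : k + 2 - (2 + i) + 1 = k + 3 - (2 + i) := by omega
    have e7 : i + 1 + 1 = 2 + i := by omega
    rw [e6, e7, egf_coeff n a _ (by omega), egf_coeff n a _ (by omega),
      Nat.cast_choose ℂ (by omega : 2 + i ≤ k + 3)]
    have := Nat.factorial_ne_zero (2 + i)
    have := Nat.factorial_ne_zero (k + 3 - (2 + i))
    field_simp
  rw [e5, e4]
  simp only [zero_add, Nat.factorial_one, Nat.cast_one, div_one]
  field_simp
  ring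

lemma dPoly_coeff (n : ℕ) (a u v : ℕ → ℂ) (s : ℂ) (hs : s ≠ 0)
    (h0 : a 0 = 0) (h1 : a 1 = s) (k : ℕ) (hk : k + 2 ≤ n) :
    (dPoly n a u v).coeff (k + 3) = 0 ↔ a (k + 2) = recRHS a u v s (k + 2) := by
  have hA := aa_coeff n a h0 k hk
  have hU := uv_sum n u v (k + 1) (by omega)
  have e0 : ∀ r, k + 2 - r - 1 = k + 1 - r := fun r => by omega
  simp only [dPoly, recRHS, Polynomial.coeff_sub, e0]
  rw [show k + 3 = (k + 1) + 2 by ring, Polynomial.coeff_X_pow_mul]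
  rw [show k + 1 + 2 = k + 3 by ring, show k + 2 - 1 = k + 1 by omega, hU,
    show k + 2 + 1 = k + 3 by ring, if_neg (by omega)]
  rw [h1] at hA
  set S := ∑ r ∈ Finset.Icc 2 (k + 1), (((k + 3).choose r : ℕ) : ℂ) * (a r * a (k + 2 - r + 1))
  have hS := eq_sub_of_add_eq' hA.symm
  rw [hS]
  have e4 : ((k + 3).factorial : ℂ) = (k + 3) * ((k + 2) * ((k + 1).factorial : ℂ)) := by
    rw [Nat.factorial_succ, Nat.factorial_succ]; push_cast; ring
  have hf : ((k + 1).factorial : ℂ) ≠ 0 := by exact_mod_cast Nat.factorial_ne_zero (k + 1)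
  have hk2 : (k : ℂ) + 2 ≠ 0 := by exact_mod_cast (by omega : k + 2 ≠ 0)
  have hk3 : (k : ℂ) + 3 ≠ 0 := by exact_mod_cast (by omega : k + 3 ≠ 0)
  have hk3' : (k : ℂ) + 2 + 1 ≠ 0 := by exact_mod_cast (by omega : k + 2 + 1 ≠ 0)
  rw [e4, eq_div_iff (by simpa using hs)]
  push_cast
  rw [show (k : ℂ) + 2 + 1 = k + 3 by ring]
  generalize (egf n a * egf n a).coeff (k + 3) = x
  generalize (egf n u * egf n v).coeff (k + 1) = y
  have key : (k + 2 : ℂ) * (((k + 1).factorial : ℂ) * y) - 1 / ((k : ℂ) + 3) *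
      ((k + 3) * ((k + 2) * ((k + 1).factorial : ℂ)) * x - 2 * (k + 3) * s * a (k + 2))
      = a (k + 2) * (2 ^ (1 - 0) * s) - (k + 2) * ((k + 1).factorial : ℂ) * (x - y) := by
    field_simp
    ring
  rw [key]
  constructor
  · intro h; rw [h]; ring
  · intro h
    have : (k + 2 : ℂ) * ((k + 1).factorial : ℂ) * (x - y) = 0 := by linear_combination h
    simpa [hk2, hf] using this

lemma all_coeff (n : ℕ) (hn : 1 ≤ n) (a u v : ℕ → ℂ) (s : ℂ) (hs : s ≠ 0)
    (h : s * s = u 0 * v 0) :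
    (∀ m ≤ n, a m = recRHS a u v s m) ↔
      (a 0 = 0 ∧ a 1 = s ∧ ∀ k ≤ n + 1, (dPoly n a u v).coeff k = 0) := by
  constructor
  · intro H
    have h0 : a 0 = 0 := by rw [H 0 (by omega), recRHS_zero]
    have h1 : a 1 = s := by rw [H 1 hn, recRHS_one a u v s hs h]
    have c0 : (egf n a).coeff 0 = 0 := by rw [egf_coeff n a 0 (by omega), h0]; simp
    have c1 : (egf n a).coeff 1 = s := by rw [egf_coeff n a 1 hn, h1]; simp
    refine ⟨h0, h1, fun k hk => ?_⟩
    match k, hk with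
    | 0, _ => simp [dPoly, c0]
    | 1, _ =>
      simp [dPoly, Polynomial.coeff_mul, Finset.Nat.antidiagonal_succ, c0, Polynomial.coeff_X_pow]
    | 2, _ =>
      have : (egf n u * egf n v).coeff 0 = u 0 * v 0 := by
        rw [Polynomial.mul_coeff_zero, egf_coeff n u 0 (by omega), egf_coeff n v 0 (by omega)]; simp
      rw [dPoly, Polynomial.coeff_sub, show (2:ℕ) = 0 + 2 by rfl, Polynomial.coeff_X_pow_mul, this]
      simp [Polynomial.coeff_mul, Finset.Nat.antidiagonal_succ, c0, c1, h]
    | k + 3, hk => exact (dPoly_coeff n a u v s hs h0 h1 k (by omega)).2 (H _ (by omega))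
  · rintro ⟨h0, h1, H⟩ m hm
    match m, hm with
    | 0, _ => rw [recRHS_zero, h0]
    | 1, _ => rw [recRHS_one a u v s hs h, h1]
    | k + 2, hm => exact (dPoly_coeff n a u v s hs h0 h1 k hm).1 (H _ (by omega))

lemma asym_iff (n : ℕ) (a u v : ℕ → ℂ) (s : ℝ)
    (hs : 0 < s) (h : (s : ℂ) * s = u 0 * v 0) (S : ℝ → ℝ) (hS0 : S 0 = s)
    (hSc : Continuous S)
    (hS : ∀ t : ℝ, (S t : ℂ) * S t = (egf n u).eval (t : ℂ) * (egf n v).eval (t : ℂ)) :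
    ((fun t : ℝ => (egf n a).eval (t : ℂ) - (t : ℂ) * (S t : ℂ))
        =o[𝓝 (0 : ℝ)] (fun t : ℝ => t ^ n)) ↔ ∀ m ≤ n, a m = recRHS a u v s m := by
  have hs' : (s : ℂ) ≠ 0 := by exact_mod_cast hs.ne'
  have htt : (fun t : ℝ => (t : ℂ)) =O[𝓝 0] (fun t : ℝ => t) := IsBigO.of_bound 1 (by simp)
  have hScC : Continuous fun t : ℝ => (S t : ℂ) := Complex.continuous_ofReal.comp hSc
  have hSb : (fun t : ℝ => (S t : ℂ)) =O[𝓝 0] (fun _ => (1 : ℝ)) :=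
    (hScC.tendsto 0).isBigO_one ℝ
  have htS : (fun t : ℝ => (t : ℂ) * (S t : ℂ)) =O[𝓝 0] (fun t : ℝ => t) := by
    simpa using htt.mul hSb
  have hd : (fun t : ℝ => (t : ℂ) * ((S t : ℂ) - s)) =o[𝓝 0] (fun t : ℝ => t) := by
    have : (fun t : ℝ => (S t : ℂ) - s) =o[𝓝 0] (fun _ => (1 : ℝ)) := by
      rw [isLittleO_one_iff]
      have := (hScC.fun_sub (continuous_const (y := (s : ℂ)))).tendsto 0
      simpa [hS0] using this
    simpa using htt.mul_isLittleO this
  rcases Nat.eq_zero_or_pos n with rfl | hn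
  · have e1 : (∀ m ≤ 0, a m = recRHS a u v s m) ↔ a 0 = 0 := by
      constructor
      · intro H; rw [H 0 le_rfl, recRHS_zero]
      · intro H m hm
        obtain rfl : m = 0 := by omega
        rw [recRHS_zero, H]
    have ht0 : (fun t : ℝ => (t : ℂ) * (S t : ℂ)) =o[𝓝 0] (fun t : ℝ => t ^ 0) := by
      refine htS.trans_isLittleO ?_
      simp only [pow_zero]
      rw [isLittleO_one_iff]
      exact tendsto_id
    have := poly_isLittleO (egf 0 a) 0
    rw [e1, ht0.sub_iff_left, this]
    constructor
    · intro H; have := H 0 le_rfl; rw [egf_coeff 0 a 0 le_rfl] at this; simpa using this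
    · intro H k hk
      rw [egf_coeff 0 a k hk]
      obtain rfl : k = 0 := by omega
      simp [H]
  rw [all_coeff n hn a u v s hs' h, ← poly_isLittleO]
  have hlin := poly_isLittleO (egf n a - Polynomial.C (s : ℂ) * Polynomial.X) 1
  have hD : ∀ t : ℝ, (dPoly n a u v).eval (t : ℂ) =
      ((egf n a).eval (t : ℂ) - (t : ℂ) * S t) * ((egf n a).eval (t : ℂ) + (t : ℂ) * S t) := by
    intro t
    simp only [dPoly, Polynomial.eval_sub, Polynomial.eval_mul, Polynomial.eval_pow,
      Polynomial.eval_X, ← hS]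
    ring
  have hpow : (fun t : ℝ => t ^ n) =O[𝓝 0] (fun t : ℝ => t) := by
    obtain ⟨j, rfl⟩ := Nat.exists_eq_add_of_le' hn
    have : (fun t : ℝ => t ^ j) =O[𝓝 (0:ℝ)] (fun _ => (1:ℝ)) :=
      ((continuous_pow j).tendsto 0).isBigO_one ℝ
    have h3 := this.mul (isBigO_refl (fun t : ℝ => t) (𝓝 0))
    simpa [pow_succ] using h3
  have hc0 : (egf n a - Polynomial.C (s : ℂ) * Polynomial.X).coeff 0 = a 0 := by
    rw [Polynomial.coeff_sub, egf_coeff n a 0 (by omega)]; simp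
  have hc1 : (egf n a - Polynomial.C (s : ℂ) * Polynomial.X).coeff 1 = a 1 - s := by
    rw [Polynomial.coeff_sub, egf_coeff n a 1 hn]; simp
  simp only [pow_one] at hlin
  constructor
  · intro H
    have H1 := H.trans_isBigO hpow
    have H2 := hlin.1 ((H1.add hd).congr_left fun t => by simp; ring)
    refine ⟨?_, ?_, ?_⟩
    · rw [← hc0]; exact H2 0 (by omega)
    · have := H2 1 le_rfl
      rw [hc1] at this
      exact sub_eq_zero.1 this
    · have H3 : (fun t : ℝ => (egf n a).eval (t : ℂ) + (t : ℂ) * S t) =O[𝓝 0] (fun t : ℝ => t) :=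
        ((H1.isBigO.add htS).add htS).congr_left fun t => by ring
      refine ((H.mul_isBigO H3).congr_left fun t => (hD t).symm).congr_right fun t => ?_
      ring
  · rintro ⟨h0, h1, H⟩
    have H2 : (fun t : ℝ => (egf n a - Polynomial.C (s : ℂ) * Polynomial.X).eval (t : ℂ))
        =o[𝓝 0] (fun t : ℝ => t) := by
      refine hlin.2 fun k hk => ?_
      interval_cases k
      · rw [hc0, h0]
      · rw [hc1, h1, sub_self]
    have H3 := H2.add hd
    rw [isLittleO_iff]
    intro c hc
    have b1 := H3.def hs
    have b2 := H.def (mul_pos hc hs)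
    filter_upwards [b1, b2] with t t1 t2
    rw [hD, norm_mul, norm_pow] at t2
    set A := (egf n a).eval (t : ℂ) with hA
    have t3 : s * ‖t‖ ≤ ‖A + (t : ℂ) * S t‖ := by
      have e : A + (t : ℂ) * S t = 2 * (s * t) +
          ((egf n a - Polynomial.C (s : ℂ) * Polynomial.X).eval (t : ℂ) + t * ((S t : ℂ) - s)) := by
        simp; ring
      have e2 : ‖(2 : ℂ) * (s * t)‖ = 2 * (s * ‖t‖) := by
        simp [abs_of_pos hs]
      rw [e]
      have := norm_sub_le_norm_add (2 * ((s : ℂ) * t))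
        ((egf n a - Polynomial.C (s : ℂ) * Polynomial.X).eval (t : ℂ) + t * ((S t : ℂ) - s))
      linarith
    rcases eq_or_ne t 0 with rfl | ht
    · have : A = 0 := by
        rw [hA, Complex.ofReal_zero, ← Polynomial.coeff_zero_eq_eval_zero,
          egf_coeff n a 0 (by omega), h0, zero_div]
      rw [this]
      simp
      positivity
    · have ht' : 0 < s * ‖t‖ := mul_pos hs (norm_pos_iff.2 ht)
      have t4 : ‖A - (t : ℂ) * S t‖ * (s * ‖t‖) ≤ (c * ‖t ^ n‖) * (s * ‖t‖) := by
        refine (mul_le_mul_of_nonneg_left t3 (norm_nonneg _)).trans (t2.trans (le_of_eq ?_))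
        rw [norm_pow]; ring
      exact le_of_mul_le_mul_right t4 ht'

/-- A polynomial in `t` solves the complex isotropic CRPC equation up
to `o(tⁿ)` iff its coefficients satisfy the recursive system of complex Poisson
equations. -/
theorem stmt_19 (Ω : Set ℂ) (hΩo : IsOpen Ω) (hΩc : IsConnected Ω) (n : ℕ)
    (f : ℕ → ℂ → ℝ) (hC2 : ∀ m ≤ n, ContDiffOn ℝ 2 (f m) Ω)
    (hpos : ∀ w ∈ Ω, (fww (f 0) w * fwbarwbar (f 0) w).im = 0 ∧
      0 < (fww (f 0) w * fwbarwbar (f 0) w).re)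
    (F : ℝ → ℂ → ℝ)
    (hF : ∀ t w, F t w = ∑ m ∈ Finset.range (n + 1), f m w * t ^ m / (m.factorial : ℝ)) :
    (∀ w ∈ Ω,
      (fun t : ℝ => fwwbar (F t) w
          - (t : ℂ) * (Real.sqrt ((fww (F t) w * fwbarwbar (F t) w).re) : ℂ))
        =o[𝓝 (0 : ℝ)] (fun t : ℝ => t ^ n)) ↔
    (∀ m ≤ n, ∀ w ∈ Ω,
      fwwbar (f m) w =
        ((m : ℂ) * ∑ r ∈ Finset.range m, (((m - 1).choose r : ℕ) : ℂ) *
            (fww (f r) w * fwbarwbar (f (m - r - 1)) w)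
          - (1 / ((m : ℂ) + 1)) * ∑ r ∈ Finset.Icc 2 (m - 1), (((m + 1).choose r : ℕ) : ℂ) *
            (fwwbar (f r) w * fwwbar (f (m - r + 1)) w))
        / ((2 : ℂ) ^ (1 - (if m = 1 then 1 else 0) : ℕ) *
            (Real.sqrt ((fww (f 0) w * fwbarwbar (f 0) w).re) : ℂ))) := by
  have hA : ∀ w ∈ Ω, ∀ t : ℝ, fwwbar (F t) w = (egf n fun m => fwwbar (f m) w).eval (t : ℂ) := by
    intro w hw t
    rw [egf_eval]
    simp only [fwwbar, wD_eq_genL, wDbar_eq_genL]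
    exact gen_expand hΩo hC2 hF _ _ hw t
  have hU : ∀ w ∈ Ω, ∀ t : ℝ, fww (F t) w = (egf n fun m => fww (f m) w).eval (t : ℂ) := by
    intro w hw t
    rw [egf_eval]
    simp only [fww, wD_eq_genL]
    exact gen_expand hΩo hC2 hF _ _ hw t
  have hV : ∀ w ∈ Ω, ∀ t : ℝ,
      fwbarwbar (F t) w = (egf n fun m => fwbarwbar (f m) w).eval (t : ℂ) := by
    intro w hw t
    rw [egf_eval]
    simp only [fwbarwbar, wDbar_eq_genL]
    exact gen_expand hΩo hC2 hF _ _ hw t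
  have hsq : ∀ g : ℂ → ℝ, ∀ w : ℂ,
      ((Real.sqrt ((fww g w * fwbarwbar g w).re) : ℝ) : ℂ) *
        ((Real.sqrt ((fww g w * fwbarwbar g w).re) : ℝ) : ℂ) = fww g w * fwbarwbar g w := by
    intro g w
    rw [fwbarwbar_eq, Complex.mul_conj, Complex.ofReal_re, ← Complex.ofReal_mul,
      Real.mul_self_sqrt (Complex.normSq_nonneg _)]
  rw [show (∀ m ≤ n, ∀ w ∈ Ω, _) ↔ (∀ w ∈ Ω, ∀ m ≤ n, _) from
    ⟨fun H w hw m hm => H m hm w hw, fun H m hm w hw => H w hw m hm⟩]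
  refine forall₂_congr fun w hw => ?_
  have hc : ∀ q : Polynomial ℂ, Continuous fun t : ℝ => q.eval (t : ℂ) := fun q =>
    q.continuous.comp Complex.continuous_ofReal
  have hF0 : F 0 = f 0 := by
    funext z
    rw [hF, Finset.sum_range_succ']
    simp
  have key := asym_iff n (fun m => fwwbar (f m) w) (fun m => fww (f m) w)
    (fun m => fwbarwbar (f m) w) (Real.sqrt ((fww (f 0) w * fwbarwbar (f 0) w).re))
    (Real.sqrt_pos.2 (hpos w hw).2) (hsq _ _)
    (fun t => Real.sqrt ((fww (F t) w * fwbarwbar (F t) w).re)) (by simp only [hF0])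
    (by
      simp only [hU w hw, hV w hw]
      exact Real.continuous_sqrt.comp (Complex.continuous_re.comp ((hc _).mul (hc _))))
    (fun t => by rw [hsq, hU w hw, hV w hw])
  simp only [← hA w hw] at key
  exact key

end
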